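/- Let a be the atom associated to (K,s), a core (I,J)-coset with I = K∖{s}, J = K∖{t}, t = w_K·s·w_K, and let b be the atom associated to (L,u), where u ∈ S∖J and L = J ∪ {u} is finitary, a core (J,M)-coset with M = L∖{v}, v = w_L·u·w_L. If the composition of a and b is not reduced, i.e. ℓ(w_K·w_J·w_L) < ℓ(w_K) − ℓ(w_J) + ℓ(w_L), then u = t, L = K, v = s and M = I; that is, b is the inverse atom W_J·w_K·W_I of a. -/

import Mathlib

namespace CoxeterAtoms

variable {B : Type*} {W : Type*} [Group W] {M : CoxeterMatrix B}

/-- The standard parabolic subgroup `W_K` generated by the simple reflections indexed by `K`. -/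
def par (cs : CoxeterSystem M W) (K : Set B) : Subgroup W :=
  Subgroup.closure (cs.simple '' K)

/-- `K` is finitary if `W_K` is finite. -/
def Finitary (cs : CoxeterSystem M W) (K : Set B) : Prop :=
  ((par cs K : Set W)).Finite

/-- The left coset `W_I · x`. -/
def lcos (cs : CoxeterSystem M W) (I : Set B) (x : W) : Set W :=
  {w | ∃ a ∈ par cs I, w = a * x}

/-- The right coset `x · W_J`. -/
def rcos (cs : CoxeterSystem M W) (x : W) (J : Set B) : Set W :=
  {w | ∃ b ∈ par cs J, w = x * b}

/-- The double coset `W_I · x · W_J`. -/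
def dcos (cs : CoxeterSystem M W) (I : Set B) (x : W) (J : Set B) : Set W :=
  {w | ∃ a ∈ par cs I, ∃ b ∈ par cs J, w = a * x * b}

/-- `x` is a minimal length element of its double coset `W_I · x · W_J`. -/
def IsMinRep (cs : CoxeterSystem M W) (I : Set B) (x : W) (J : Set B) : Prop :=
  ∀ w ∈ dcos cs I x J, cs.length x ≤ cs.length w

/-- `y` is a maximal length element of the set `p`. -/
def IsMaxOf (cs : CoxeterSystem M W) (p : Set W) (y : W) : Prop :=
  y ∈ p ∧ ∀ w ∈ p, cs.length w ≤ cs.length y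

/-- `y` is the longest element of the standard parabolic subgroup `W_K`. -/
def IsLongest (cs : CoxeterSystem M W) (K : Set B) (y : W) : Prop :=
  y ∈ par cs K ∧ ∀ w ∈ par cs K, cs.length w ≤ cs.length y

/-- The double coset `W_I · x · W_J` is core: `W_I·x = W_I·x·W_J = x·W_J`. -/
def IsCore (cs : CoxeterSystem M W) (I : Set B) (x : W) (J : Set B) : Prop :=
  lcos cs I x = dcos cs I x J ∧ dcos cs I x J = rcos cs x J

section Helpers

open CoxeterSystem Polynomial

/-! ### Simple reflections are pairwise distinct (geometric representation) -/

/-- The coroot functional of the geometric representation. -/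
noncomputable def coroot (M : CoxeterMatrix B) (i : B) : (B →₀ ℝ) →ₗ[ℝ] ℝ :=
  Finsupp.linearCombination ℝ (fun j => -2 * Real.cos (Real.pi / (M i j : ℝ)))

theorem coroot_single (i j : B) :
    coroot M i (Finsupp.single j 1) = -2 * Real.cos (Real.pi / (M i j : ℝ)) := by
  simp [coroot]

theorem coroot_self (i : B) : coroot M i (Finsupp.single i 1) = 2 := by
  simp [coroot_single]

theorem sin_mul_S (θ : ℝ) (k : ℤ) :
    (Chebyshev.S ℝ k).eval (2 * Real.cos θ) * Real.sin θ = Real.sin ((k + 1) * θ) := by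
  have h := Chebyshev.U_real_cos θ k
  rw [Chebyshev.S_eq_U_comp_half_mul_X]
  simpa using h

theorem geom_liftable (M : CoxeterMatrix B) :
    M.IsLiftable (fun i => Module.reflection (coroot_self (M := M) i)) := by
  intro i j
  by_cases hij : i = j
  · subst hij
    rw [M.diagonal, pow_one]
    ext z
    simp [Module.involutive_reflection (coroot_self (M := M) i) _]
  have hm1 : M i j ≠ 1 := M.off_diagonal i j hij
  have hsymm : M j i = M i j := M.symmetric j i
  by_cases hm0 : M i j = 0
  · rw [hm0, pow_zero]
  apply LinearEquiv.toLinearMap_injective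
  refine LinearMap.ext fun z => ?_
  by_cases hm2 : M i j = 2
  · have e1 : coroot M i (Finsupp.single j 1) = 0 := by simp [coroot_single, hm2]
    have e2 : coroot M j (Finsupp.single i 1) = 0 := by simp [coroot_single, hsymm, hm2]
    simp only [hm2, sq, LinearEquiv.coe_coe, LinearEquiv.mul_apply, Module.reflection_apply,
      map_sub, map_smul, coroot_self, e1, e2, LinearEquiv.coe_one, id]
    module
  have hm3 : 3 ≤ M i j := by omega
  generalize hmm : M i j = m at *
  have hm3' : (3 : ℝ) ≤ m := by exact_mod_cast hm3
  set θ : ℝ := 2 * (Real.pi / m) with hθ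
  have ht : 2 * Real.cos θ = coroot M i (Finsupp.single j 1) * coroot M j (Finsupp.single i 1) - 2 := by
    rw [coroot_single, coroot_single, hsymm, hmm, hθ, Real.cos_two_mul]
    ring
  have hmθ : (m : ℝ) * θ = 2 * Real.pi := by
    rw [hθ]; field_simp
  have hpos : 0 < θ := by positivity
  have hsin : Real.sin θ ≠ 0 := by
    apply ne_of_gt
    apply Real.sin_pos_of_pos_of_lt_pi hpos
    nlinarith [Real.pi_pos]
  have hpow := Module.reflection_mul_reflection_pow_apply (coroot_self (M := M) i)
    (coroot_self (M := M) j) m z (2 * Real.cos θ) ht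
  have hz : ∀ k : ℤ, Real.sin ((k + 1) * θ) = 0 →
      (Chebyshev.S ℝ k).eval (2 * Real.cos θ) = 0 := by
    intro k hk
    rw [← sin_mul_S] at hk
    exact (mul_eq_zero.1 hk).resolve_right hsin
  simp only [LinearEquiv.coe_coe]
  rw [hpow]
  rcases Nat.even_or_odd' m with ⟨k, hk | hk⟩
  · have a1 : ((m : ℤ) - 2) / 2 = k - 1 := by omega
    have a2 : ((m : ℤ) - 1) / 2 = k - 1 := by omega
    have h0 : (Chebyshev.S ℝ ((k : ℤ) - 1)).eval (2 * Real.cos θ) = 0 := by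
      apply hz
      have : ((((k : ℤ) - 1 : ℤ) : ℝ) + 1) * θ = Real.pi := by
        rw [hk] at hmθ
        push_cast at hmθ ⊢
        linarith
      rw [this, Real.sin_pi]
    rw [a1, a2, h0]
    simp
  · have a1 : ((m : ℤ) - 2) / 2 = k - 1 := by omega
    have a2 : ((m : ℤ) - 1) / 2 = k := by omega
    have a3 : ((m : ℤ) - 3) / 2 = k - 1 := by omega
    have a4 : (m : ℤ) / 2 = k := by omega
    have h0 : (Chebyshev.S ℝ (k : ℤ)).eval (2 * Real.cos θ) +
        (Chebyshev.S ℝ ((k : ℤ) - 1)).eval (2 * Real.cos θ) = 0 := by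
      have b1 := sin_mul_S θ k
      have b2 := sin_mul_S θ (k - 1)
      have b3 : (((k : ℤ) : ℝ) + 1) * θ = 2 * Real.pi - ((((k : ℤ) - 1 : ℤ) : ℝ) + 1) * θ := by
        rw [hk] at hmθ
        push_cast at hmθ ⊢
        linarith
      rw [b3, Real.sin_two_pi_sub] at b1
      have : ((Chebyshev.S ℝ (k : ℤ)).eval (2 * Real.cos θ) +
        (Chebyshev.S ℝ ((k : ℤ) - 1)).eval (2 * Real.cos θ)) * Real.sin θ = 0 := by
        rw [add_mul, b1, b2]; ring
      exact (mul_eq_zero.1 this).resolve_right hsin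
    rw [a1, a2, a3, a4, h0]
    simp

theorem simple_inj (cs : CoxeterSystem M W) {i j : B} (h : cs.simple i = cs.simple j) : i = j := by
  by_contra hij
  have h1 := cs.lift_apply_simple (geom_liftable M) i
  have h2 := cs.lift_apply_simple (geom_liftable M) j
  rw [h, h2] at h1
  have h3 := congrArg (fun r => (r (Finsupp.single i 1)) i) h1
  have hij' : j ≠ i := fun h => hij h.symm
  simp [Module.reflection_apply, coroot_self, Finsupp.single_apply, hij'] at h3
  norm_num at h3

/-! ### The exchange condition -/

open Classical in
/-- The action of a simple reflection on `W × ℤ/2`. -/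
noncomputable def flip (cs : CoxeterSystem M W) (i : B) : Function.End (W × ZMod 2) :=
  fun p => (cs.simple i * p.1 * cs.simple i, p.2 + if p.1 = cs.simple i then 1 else 0)

open Classical in
theorem flip_word (cs : CoxeterSystem M W) (ω : List B) (p : W × ZMod 2) :
    (ω.map (flip cs)).prod p =
      (cs.wordProd ω * p.1 * (cs.wordProd ω)⁻¹, p.2 + ((cs.rightInvSeq ω).count p.1 : ℕ)) := by
  induction ω with
  | nil => simp; rfl
  | cons i ω ih =>
    rw [List.map_cons, List.prod_cons]
    change flip cs i ((ω.map (flip cs)).prod p) = _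
    rw [ih]
    simp only [flip, wordProd_cons, rightInvSeq, List.count_cons]
    refine Prod.ext ?_ ?_
    · simp [mul_assoc]
    · have : (cs.wordProd ω * p.1 * (cs.wordProd ω)⁻¹ = cs.simple i) ↔
          ((cs.wordProd ω)⁻¹ * cs.simple i * cs.wordProd ω = p.1) := by
        constructor
        · intro h; rw [← h]; group
        · intro h; rw [← h]; group
      simp only [this, beq_iff_eq]
      push_cast
      rw [add_assoc]

theorem alt_reverse (i j : B) (m : ℕ) :
    (alternatingWord j i (2 * m)).reverse = alternatingWord i j (2 * m) := by
  apply List.ext_getElem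
  · simp
  · intro k h1 h2
    simp only [length_alternatingWord, List.length_reverse] at h1 h2
    rw [List.getElem_reverse]
    simp only [length_alternatingWord]
    rw [getElem_alternatingWord _ _ _ _ (by omega), getElem_alternatingWord _ _ _ _ h2]
    simp only [Nat.even_iff]
    split_ifs <;> first | rfl | omega

open Classical in
theorem alt_count (cs : CoxeterSystem M W) (i j : B) (t : W) :
    (((cs.rightInvSeq (alternatingWord i j (2 * M i j))).count t : ℕ) : ZMod 2) = 0 := by
  rw [← alt_reverse, rightInvSeq_reverse, List.count_reverse]
  have hlen : (cs.leftInvSeq (alternatingWord j i (2 * M i j))).length = 2 * M i j := by simp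
  have hdup : (cs.leftInvSeq (alternatingWord j i (2 * M i j))).drop (M i j) =
      (cs.leftInvSeq (alternatingWord j i (2 * M i j))).take (M i j) := by
    apply List.ext_getElem
    · simp; omega
    · intro k h1 h2
      have hk : k < M i j := by
        rw [List.length_drop, hlen] at h1; omega
      rw [List.getElem_drop, List.getElem_take,
        getElem_leftInvSeq_alternatingWord cs j i _ _ (by omega),
        getElem_leftInvSeq_alternatingWord cs j i _ _ (by omega),
        prod_alternatingWord_eq_mul_pow, prod_alternatingWord_eq_mul_pow]
      have e1 : (2 * (M i j + k) + 1) / 2 = M i j + k := by omega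
      have e2 : (2 * k + 1) / 2 = k := by omega
      rw [e1, e2, pow_add, simple_mul_simple_pow]
      simp
  rw [← List.take_append_drop (M i j) (cs.leftInvSeq (alternatingWord j i (2 * M i j))), hdup,
    List.count_append]
  push_cast
  exact CharTwo.add_self_eq_zero _

theorem alt_map {G : Type*} [Monoid G] (f : B → G) (i j : B) (m : ℕ) :
    ((alternatingWord i j (2 * m)).map f).prod = (f i * f j) ^ m := by
  induction m with
  | zero => simp [alternatingWord]
  | succ m ih =>
    rw [show 2 * (m + 1) = 2 * m + 1 + 1 by ring, alternatingWord_succ, alternatingWord_succ]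
    simp [ih, pow_succ, mul_assoc]

theorem flip_liftable (cs : CoxeterSystem M W) : M.IsLiftable (flip cs) := by
  intro i j
  rw [← alt_map]
  funext p
  rw [flip_word, alt_count, wordProd, alt_map]
  simp
  rfl

open Classical in
theorem count_eq (cs : CoxeterSystem M W) {ω ω' : List B} (h : cs.wordProd ω = cs.wordProd ω')
    (t : W) : (((cs.rightInvSeq ω).count t : ℕ) : ZMod 2) = ((cs.rightInvSeq ω').count t : ℕ) := by
  have key : ∀ ω : List B, cs.lift ⟨flip cs, flip_liftable cs⟩ (cs.wordProd ω) =
      (ω.map (flip cs)).prod := by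
    intro ω
    rw [wordProd, map_list_prod, List.map_map]
    congr 1
    apply List.map_congr_left
    intro i _
    exact cs.lift_apply_simple (flip_liftable cs) i
  have h1 := congrFun (key ω) (t, 0)
  have h2 := congrFun (key ω') (t, 0)
  rw [flip_word] at h1 h2
  rw [h, h2] at h1
  simpa using (congrArg Prod.snd h1).symm

theorem exch (cs : CoxeterSystem M W) (ω : List B) (i : B)
    (h : cs.length (cs.wordProd ω * cs.simple i) < cs.length (cs.wordProd ω)) :
    ∃ j < ω.length, cs.wordProd ω * cs.simple i = cs.wordProd (ω.eraseIdx j) := by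
  classical
  obtain ⟨τ, hτ, hτw⟩ := cs.exists_isReduced (cs.wordProd ω * cs.simple i)
  have hw : cs.wordProd (τ.concat i) = cs.wordProd ω := by
    rw [wordProd_concat, ← hτw]; simp
  have hred : cs.IsReduced (τ.concat i) := by
    have h1 := cs.length_wordProd_le (τ.concat i)
    unfold CoxeterSystem.IsReduced at hτ ⊢
    rw [hw] at h1 ⊢
    rw [← hτw] at hτ
    simp at h1 ⊢
    omega
  have hc : (cs.rightInvSeq (τ.concat i)).count (cs.simple i) = 1 := by
    apply List.count_eq_one_of_mem hred.nodup_rightInvSeq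
    rw [rightInvSeq_concat]; simp
  have h2 := count_eq cs hw (cs.simple i)
  rw [hc] at h2
  have hmem : cs.simple i ∈ cs.rightInvSeq ω := by
    by_contra hn
    rw [List.count_eq_zero_of_not_mem hn] at h2
    simp at h2
  obtain ⟨j, hj, hje⟩ := List.getElem_of_mem hmem
  refine ⟨j, by simpa using hj, ?_⟩
  rw [← wordProd_mul_getD_rightInvSeq, List.getD_eq_getElem _ _ hj, hje]

theorem exch2 (cs : CoxeterSystem M W) (x y : W) (i : B)
    (h : cs.length (x * y * cs.simple i) < cs.length (x * y)) :
    cs.length (y * cs.simple i) < cs.length y ∨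
      ∃ x', cs.length x' < cs.length x ∧ x * y * cs.simple i = x' * y := by
  obtain ⟨a, ha, rfl⟩ := cs.exists_isReduced x
  obtain ⟨b, hb, rfl⟩ := cs.exists_isReduced y
  rw [← wordProd_append] at h
  obtain ⟨j, hj, hje⟩ := exch cs (a ++ b) i h
  unfold CoxeterSystem.IsReduced at ha hb
  by_cases hja : j < a.length
  · right
    rw [List.eraseIdx_append_of_lt_length hja] at hje
    refine ⟨cs.wordProd (a.eraseIdx j), ?_, ?_⟩
    · have h1 := cs.length_wordProd_le (a.eraseIdx j)
      rw [List.length_eraseIdx_of_lt hja] at h1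
      omega
    · rw [← wordProd_append, hje, wordProd_append]
  · left
    have hja' : a.length ≤ j := by omega
    rw [List.eraseIdx_append_of_length_le hja', wordProd_append, wordProd_append, mul_assoc] at hje
    have hje := mul_left_cancel hje
    rw [hje]
    have h1 := cs.length_wordProd_le (b.eraseIdx (j - a.length))
    simp at hj
    rw [List.length_eraseIdx_of_lt (by omega)] at h1
    omega

/-! ### Parabolic subgroups -/

theorem simple_mem (cs : CoxeterSystem M W) {K : Set B} {i : B} (h : i ∈ K) :
    cs.simple i ∈ par cs K := Subgroup.subset_closure ⟨i, h, rfl⟩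

theorem word_mem (cs : CoxeterSystem M W) {K : Set B} {ω : List B} (h : ∀ i ∈ ω, i ∈ K) :
    cs.wordProd ω ∈ par cs K := by
  apply Subgroup.list_prod_mem
  intro x hx
  obtain ⟨i, hi, rfl⟩ := List.mem_map.1 hx
  exact simple_mem cs (h i hi)

theorem exists_red (cs : CoxeterSystem M W) {K : Set B} {w : W} (hw : w ∈ par cs K) :
    ∃ ω : List B, cs.IsReduced ω ∧ (∀ i ∈ ω, i ∈ K) ∧ w = cs.wordProd ω := by
  have step : ∀ (x : W) (i : B), i ∈ K →
      (∃ ω : List B, cs.IsReduced ω ∧ (∀ i ∈ ω, i ∈ K) ∧ x = cs.wordProd ω) →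
      ∃ ω : List B, cs.IsReduced ω ∧ (∀ i ∈ ω, i ∈ K) ∧ x * cs.simple i = cs.wordProd ω := by
    rintro x i hi ⟨ω, hr, hm, rfl⟩
    unfold CoxeterSystem.IsReduced at hr
    rcases cs.length_mul_simple (cs.wordProd ω) i with h | h
    · refine ⟨ω.concat i, ?_, ?_, (cs.wordProd_concat i ω).symm⟩
      · unfold CoxeterSystem.IsReduced; rw [wordProd_concat, h, hr]; simp
      · intro k hk
        simp at hk
        rcases hk with hk | rfl
        · exact hm k hk
        · exact hi
    · obtain ⟨j, hj, hje⟩ := exch cs ω i (by omega)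
      refine ⟨ω.eraseIdx j, ?_, ?_, hje⟩
      · unfold CoxeterSystem.IsReduced; rw [← hje, List.length_eraseIdx_of_lt hj]; omega
      · intro k hk; exact hm k (List.mem_of_mem_eraseIdx hk)
  refine Subgroup.closure_induction_right
    (p := fun w _ => ∃ ω : List B, cs.IsReduced ω ∧ (∀ i ∈ ω, i ∈ K) ∧ w = cs.wordProd ω)
    ?_ ?_ ?_ hw
  · exact ⟨[], by simp [CoxeterSystem.IsReduced], by simp, by simp⟩
  · rintro x _ _ ⟨i, hi, rfl⟩ h
    exact step x i hi h
  · rintro x _ _ ⟨i, hi, rfl⟩ h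
    rw [inv_simple]
    exact step x i hi h

theorem par_induction (cs : CoxeterSystem M W) {K : Set B} {p : W → Prop} (h1 : p 1)
    (hs : ∀ y i, y ∈ par cs K → i ∈ K → cs.length (y * cs.simple i) = cs.length y + 1 → p y →
      p (y * cs.simple i)) {w : W} (hw : w ∈ par cs K) : p w := by
  obtain ⟨ω, hr, hm, rfl⟩ := exists_red cs hw
  clear hw
  induction ω using List.reverseRecOn with
  | nil => simpa using h1
  | append_singleton ω i ih =>
    have hr' : cs.IsReduced ω := by simpa using hr.take ω.length
    have hmw : ∀ k ∈ ω, k ∈ K := fun k hk => hm k (by simp [hk])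
    rw [wordProd_append, wordProd_singleton]
    apply hs _ _ (word_mem cs hmw) (hm i (by simp)) _ (ih hr' hmw)
    unfold CoxeterSystem.IsReduced at hr hr'
    rw [wordProd_append, wordProd_singleton] at hr
    rw [hr, hr']; simp

theorem simple_mem_iff (cs : CoxeterSystem M W) {K : Set B} {i : B} :
    cs.simple i ∈ par cs K ↔ i ∈ K := by
  refine ⟨fun h => ?_, simple_mem cs⟩
  obtain ⟨ω, hr, hm, he⟩ := exists_red cs h
  unfold CoxeterSystem.IsReduced at hr
  rw [← he, length_simple] at hr
  obtain ⟨k, rfl⟩ := List.length_eq_one_iff.1 hr.symm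
  rw [wordProd_singleton] at he
  rw [simple_inj cs he]
  exact hm k (by simp)

theorem not_descent (cs : CoxeterSystem M W) {K : Set B} {x : W} (hx : x ∈ par cs K) {i : B}
    (hi : i ∉ K) : cs.length x < cs.length (x * cs.simple i) := by
  by_contra hn
  have hne := cs.length_mul_simple_ne x i
  obtain ⟨ω, hr, hm, rfl⟩ := exists_red cs hx
  obtain ⟨j, hj, hje⟩ := exch cs ω i (by omega)
  apply hi
  rw [← simple_mem_iff cs]
  have h2 : cs.wordProd (ω.eraseIdx j) ∈ par cs K :=
    word_mem cs (fun k hk => hm k (List.mem_of_mem_eraseIdx hk))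
  rw [← hje] at h2
  exact (Subgroup.mul_mem_cancel_left _ hx).1 h2

theorem add_of_min (cs : CoxeterSystem M W) {L : Set B} {x : W}
    (hmin : ∀ z ∈ par cs L, cs.length x ≤ cs.length (x * z)) {y : W} (hy : y ∈ par cs L) :
    cs.length (x * y) = cs.length x + cs.length y := by
  refine par_induction cs (p := fun y => cs.length (x * y) = cs.length x + cs.length y)
    (by simp) ?_ hy
  intro y i hy hi hl ih
  rw [← mul_assoc]
  rcases cs.length_mul_simple (x * y) i with h | h
  · omega
  · exfalso
    rcases exch2 cs x y i (by omega) with h' | ⟨x', hx', he⟩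
    · omega
    · have := hmin (y * cs.simple i * y⁻¹)
        (mul_mem (mul_mem hy (simple_mem cs hi)) (inv_mem hy))
      rw [← mul_assoc, ← mul_assoc, he] at this
      simp at this
      omega

theorem exists_min (cs : CoxeterSystem M W) (L : Set B) (x : W) :
    ∃ m, ∃ z ∈ par cs L, x = m * z ∧ ∀ z ∈ par cs L, cs.length m ≤ cs.length (m * z) := by
  classical
  have hex : ∃ n, ∃ z ∈ par cs L, cs.length (x * z) = n := ⟨_, 1, one_mem _, rfl⟩
  obtain ⟨z, hz, hzn⟩ := Nat.find_spec hex
  refine ⟨x * z, z⁻¹, inv_mem hz, by simp, fun y hy => ?_⟩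
  rw [hzn]
  exact Nat.find_min' hex ⟨z * y, mul_mem hz hy, by rw [mul_assoc]⟩

theorem add_of_not_descent (cs : CoxeterSystem M W) {L : Set B} {x : W}
    (hx : ∀ i ∈ L, cs.length x ≤ cs.length (x * cs.simple i)) {y : W} (hy : y ∈ par cs L) :
    cs.length (x * y) = cs.length x + cs.length y := by
  obtain ⟨m, z, hz, hxm, hm⟩ := exists_min cs L x
  obtain ⟨ω, hr, hmem, he⟩ := exists_red cs hz
  rcases List.eq_nil_or_concat ω with rfl | ⟨τ, i, rfl⟩
  · simp at he
    rw [he, mul_one] at hxm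
    rw [hxm]
    exact add_of_min cs hm hy
  · exfalso
    have h1 := hx i (hmem i (by simp))
    have h2 : x * cs.simple i = m * cs.wordProd τ := by
      rw [hxm, he]; simp [wordProd_append, mul_assoc]
    have h3 := cs.length_mul_le m (cs.wordProd τ)
    have h4 := cs.length_wordProd_le τ
    have h5 := add_of_min cs hm hz
    unfold CoxeterSystem.IsReduced at hr
    rw [← he] at hr
    simp at hr
    rw [h2] at h1
    rw [hxm] at h1
    omega

theorem longest_factor (cs : CoxeterSystem M W) {J : Set B} {y : W} (hy : IsLongest cs J y)
    {z : W} (hz : z ∈ par cs J) : ∃ a, y = a * z ∧ cs.length a + cs.length z = cs.length y := by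
  refine par_induction cs (p := fun z => ∃ a, y = a * z ∧ cs.length a + cs.length z = cs.length y)
    ⟨y, by simp⟩ ?_ hz
  rintro z i hz hi hl ⟨a, he, hla⟩
  have h1 := hy.2 (y * cs.simple i) (mul_mem hy.1 (simple_mem cs hi))
  have h2 := cs.length_mul_simple_ne y i
  rcases exch2 cs a z i (by rw [← he]; omega) with h' | ⟨x', hx', he'⟩
  · omega
  · have h3 : y = x' * (z * cs.simple i) := by
      rw [← mul_assoc, ← he', ← he]; simp
    refine ⟨x', h3, ?_⟩
    have h4 := cs.length_mul_le x' (z * cs.simple i)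
    rw [← h3] at h4
    omega

theorem longest_unique (cs : CoxeterSystem M W) {J : Set B} {y z : W} (hy : IsLongest cs J y)
    (hz : IsLongest cs J z) : y = z := by
  obtain ⟨a, he, hl⟩ := longest_factor cs hy hz.1
  have h1 := hz.2 y hy.1
  have h2 : a = 1 := cs.length_eq_zero_iff.1 (by omega)
  simpa [h2] using he

theorem longest_inv (cs : CoxeterSystem M W) {J : Set B} {y : W} (hy : IsLongest cs J y) :
    y⁻¹ = y :=
  longest_unique cs ⟨inv_mem hy.1, fun w hw => by rw [length_inv]; exact hy.2 w hw⟩ hy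

theorem par_mono (cs : CoxeterSystem M W) {J K : Set B} (h : J ⊆ K) : par cs J ≤ par cs K :=
  Subgroup.closure_mono (Set.image_mono h)

end Helpers

theorem statement_5 (cs : CoxeterSystem M W)
    (K : Set B) (hK : Finitary cs K) (s t : B) (hs : s ∈ K) (ht : t ∈ K)
    (wK : W) (hwK : IsLongest cs K wK)
    (hts : cs.simple t = wK * cs.simple s * wK)
    (J : Set B) (hJ : J = K \ {t})
    (u : B) (hu : u ∉ J) (L : Set B) (hL : L = J ∪ {u}) (hLfin : Finitary cs L)
    (v : B) (hv : v ∈ L)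
    (wL wJ : W) (hwL : IsLongest cs L wL) (hwJ : IsLongest cs J wJ)
    (hvu : cs.simple v = wL * cs.simple u * wL)
    (Mset : Set B) (hM : Mset = L \ {v})
    (hnred : (cs.length (wK * wJ * wL) : ℤ) <
      (cs.length wK : ℤ) - cs.length wJ + cs.length wL) :
    u = t ∧ L = K ∧ v = s ∧ Mset = K \ {s} := by
  have hJK : J ⊆ K := by rw [hJ]; exact Set.sdiff_subset
  by_cases hut : u = t
  · have hLK : L = K := by
      rw [hL, hJ, hut, Set.sdiff_union_self, Set.union_eq_self_of_subset_right]
      simpa using ht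
    rw [hLK] at hwL
    have hw := longest_unique cs hwL hwK
    have hsq : wK * wK = 1 := by
      nth_rewrite 1 [← longest_inv cs hwK]; simp
    have hvs : v = s := by
      apply simple_inj cs
      rw [hvu, hut, hts, hw]
      calc wK * (wK * cs.simple s * wK) * wK = (wK * wK) * cs.simple s * (wK * wK) := by group
        _ = cs.simple s := by rw [hsq]; simp
    exact ⟨hut, hLK, hvs, by rw [hM, hLK, hvs]⟩
  · exfalso
    have huK : u ∉ K := fun h => hu (by rw [hJ]; exact ⟨h, hut⟩)
    obtain ⟨m, z, hz, he, hm⟩ := exists_min cs J wK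
    have hlz := add_of_min cs hm hz
    have hlw := add_of_min cs hm hwJ.1
    have hmK : m ∈ par cs K := by
      have : m = wK * z⁻¹ := by rw [he]; simp
      rw [this]
      exact mul_mem hwK.1 (inv_mem (par_mono cs hJK hz))
    have h1 := hwK.2 (m * wJ) (mul_mem hmK (par_mono cs hJK hwJ.1))
    rw [← he] at hlz
    have hzJ : z = wJ := by
      refine longest_unique cs ⟨hz, fun w hw => ?_⟩ hwJ
      have := hwJ.2 w hw
      omega
    have hx : wK * wJ = m := by
      rw [he, hzJ]
      nth_rewrite 2 [← longest_inv cs hwJ]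
      simp
    have hadd : cs.length (m * wL) = cs.length m + cs.length wL := by
      refine add_of_not_descent cs ?_ hwL.1
      intro i hi
      rw [hL] at hi
      rcases hi with hi | hi
      · exact hm _ (simple_mem cs hi)
      · rw [Set.mem_singleton_iff] at hi
        rw [hi]
        exact (not_descent cs hmK huK).le
    rw [hx, hadd] at hnred
    rw [hzJ] at hlz
    push_cast at hnred
    omega

end CoxeterAtoms
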